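/- arXiv:2309.13346 — 2 statements merged into one kernel-verified Lean document; each statement's English description precedes it below -/
import Mathlib

section
/- Let F be a field of characteristic 2, and let φ and ψ be totally singular quadratic forms (diagonal quasilinear 2-forms) over F such that the anisotropic part φ_an of φ is minimal over F. If φ and ψ are weakly Vishik equivalent, then φ and ψ are similar. -/
/-!
Diagonal quasilinear `p`-forms over a field `F` of characteristic `p`,
following Hoffmann and Zemková. A form of dimension `n` is recorded by its
coefficient tuple `a : ι → F` (for a finite index type `ι`), the form being
`x ↦ ∑ i, a i * (x i)^p`.
-/

universe u

namespace QLF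

open scoped BigOperators

/-- Evaluation of the diagonal quasilinear `p`-form with coefficients `a` at `x`. -/
def eval (p : ℕ) {F : Type*} [CommRing F] {ι : Type*} [Fintype ι]
    (a : ι → F) (x : ι → F) : F :=
  ∑ i, a i * x i ^ p

/-- A form is isotropic if it has a nontrivial zero. -/
def Isotropic (p : ℕ) {F : Type*} [CommRing F] {ι : Type*} [Fintype ι] (a : ι → F) : Prop :=
  ∃ x : ι → F, x ≠ 0 ∧ eval p a x = 0

/-- A form is anisotropic if it has no nontrivial zero. -/
def Anisotropic (p : ℕ) {F : Type*} [CommRing F] {ι : Type*} [Fintype ι] (a : ι → F) : Prop :=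
  ¬ Isotropic p a

/-- In characteristic `p`, the zero set of a diagonal quasilinear `p`-form is a
linear subspace. -/
def zeroSubmodule (p : ℕ) [Fact p.Prime] {F : Type*} [Field F] [CharP F p]
    {ι : Type*} [Fintype ι] (a : ι → F) : Submodule F (ι → F) where
  carrier := {x | eval p a x = 0}
  zero_mem' := by
    have hp : p ≠ 0 := (Fact.out : p.Prime).ne_zero
    simp [eval, zero_pow hp]
  add_mem' := by
    intro x y hx hy
    haveI : ExpChar F p := .prime Fact.out
    have hxy : eval p a (x + y) = eval p a x + eval p a y := by
      simp only [eval, Pi.add_apply]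
      rw [← Finset.sum_add_distrib]
      exact Finset.sum_congr rfl fun i _ => by rw [add_pow_char, mul_add]
    simp only [Set.mem_setOf_eq] at *
    rw [hxy, hx, hy, add_zero]
  smul_mem' := by
    intro c x hx
    simp only [Set.mem_setOf_eq] at *
    have hcx : eval p a (c • x) = c ^ p * eval p a x := by
      simp only [eval, Pi.smul_apply, smul_eq_mul, Finset.mul_sum]
      exact Finset.sum_congr rfl fun i _ => by rw [mul_pow]; ring
    rw [hcx, hx, mul_zero]

/-- The defect `i₀` of a form: the dimension of its zero set. -/
noncomputable def defect (p : ℕ) [Fact p.Prime] {F : Type*} [Field F] [CharP F p]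
    {ι : Type*} [Fintype ι] (a : ι → F) : ℕ :=
  Module.finrank F (zeroSubmodule p a)

/-- Isometry of forms: a linear bijection carrying one form into the other. -/
def Isometric (p : ℕ) {F : Type*} [Field F] {ι κ : Type*} [Fintype ι] [Fintype κ]
    (a : ι → F) (b : κ → F) : Prop :=
  ∃ T : (ι → F) ≃ₗ[F] (κ → F), ∀ x, eval p a x = eval p b (T x)

/-- `a` is a subform of `b`. -/
def Subform (p : ℕ) {F : Type*} [Field F] {ι κ : Type*} [Fintype ι] [Fintype κ]
    (a : ι → F) (b : κ → F) : Prop :=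
  ∃ T : (ι → F) →ₗ[F] (κ → F), Function.Injective T ∧ ∀ x, eval p a x = eval p b (T x)

/-- Similarity of forms: `a ≃ c·b` for some scalar `c ≠ 0`. -/
def Similar (p : ℕ) {F : Type*} [Field F] {ι κ : Type*} [Fintype ι] [Fintype κ]
    (a : ι → F) (b : κ → F) : Prop :=
  ∃ c : F, c ≠ 0 ∧ Isometric p a (fun i => c * b i)

/-- Vishik equivalence: same dimension, and equal defects over every field
extension `E/F`. -/
def VishikEquiv (p : ℕ) [Fact p.Prime] {F : Type u} [Field F] [CharP F p]
    {ι κ : Type*} [Fintype ι] [Fintype κ] (a : ι → F) (b : κ → F) : Prop :=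
  Fintype.card ι = Fintype.card κ ∧
    ∀ (E : Type u) [Field E] [CharP E p] (f : F →+* E),
      defect p (f ∘ a) = defect p (f ∘ b)

/-- Weak Vishik equivalence: same dimension, and equal defects over every field
extension of the shape `E = F(α)` with `αᵖ ∈ F` (this includes `E = F`). -/
def WeakVishikEquiv (p : ℕ) [Fact p.Prime] {F : Type u} [Field F] [CharP F p]
    {ι κ : Type*} [Fintype ι] [Fintype κ] (a : ι → F) (b : κ → F) : Prop :=
  Fintype.card ι = Fintype.card κ ∧
    ∀ (E : Type u) [Field E] [CharP E p] (f : F →+* E) (α : E),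
      α ^ p ∈ Set.range ⇑f →
      Subfield.closure (insert α (Set.range ⇑f)) = ⊤ →
      defect p (f ∘ a) = defect p (f ∘ b)

/-- The set `Fᵖ` of `p`-th powers. -/
def pSet (p : ℕ) (F : Type*) [Field F] : Set F := Set.range fun x : F => x ^ p

/-- The subfield `Fᵖ` of `p`-th powers (in characteristic `p` the set of `p`-th
powers is already a subfield, so the closure adds nothing). -/
def pthSubfield (p : ℕ) (F : Type*) [Field F] : Subfield F :=
  Subfield.closure (pSet p F)

/-- The subfield `Fᵖ(s)` generated by a set `s` over `Fᵖ`. -/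
def adjoin (p : ℕ) {F : Type*} [Field F] (s : Set F) : Subfield F :=
  Subfield.closure (pSet p F ∪ s)

/-- The degree `[N : k]` of a subfield `N` over a subfield `k` (for `k ≤ N`,
the `k`-span of `N` in `F` is `N` itself, so this is the `k`-dimension of `N`). -/
noncomputable def degOver {F : Type*} [Field F] (k : Subfield F) (N : Subfield F) : ℕ :=
  Module.finrank k (Submodule.span k (N : Set F))

/-- The set `D_F(φ)` of values of the form. -/
def values (p : ℕ) {F : Type*} [CommRing F] {ι : Type*} [Fintype ι] (a : ι → F) : Set F :=
  Set.range (eval p a)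

/-- The norm field `N_F(φ)`: the subfield generated over `Fᵖ` by all quotients
of nonzero values of `φ`. -/
def normField (p : ℕ) {F : Type*} [Field F] {ι : Type*} [Fintype ι] (a : ι → F) : Subfield F :=
  adjoin p {z : F | ∃ u ∈ values p a, ∃ v ∈ values p a, u ≠ 0 ∧ v ≠ 0 ∧ z = u / v}

/-- The norm degree `ndeg_F(φ) = [N_F(φ) : Fᵖ]`. -/
noncomputable def ndeg (p : ℕ) {F : Type*} [Field F] {ι : Type*} [Fintype ι] (a : ι → F) : ℕ :=
  degOver (pthSubfield p F) (normField p a)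

/-- An anisotropic form is minimal if `ndeg_F(φ) = p^(dim φ - 1)`. -/
def Minimal (p : ℕ) {F : Type*} [Field F] {ι : Type*} [Fintype ι] (a : ι → F) : Prop :=
  Anisotropic p a ∧ ndeg p a = p ^ (Fintype.card ι - 1)

/-- The quasi-Pfister form `⟪b₁,…,bₙ⟫`: its coefficients are all products
`b₁^{e₁}⋯bₙ^{eₙ}` with `0 ≤ eᵢ ≤ p-1`. -/
def pfister (p : ℕ) {F : Type*} [CommRing F] {n : ℕ} (b : Fin n → F) :
    (Fin n → Fin p) → F :=
  fun e => ∏ i, b i ^ (e i : ℕ)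

/-- A form is a quasi-Pfister form if it is isometric to some `⟪b₁,…,bₙ⟫`
with all `bᵢ ∈ F×`. -/
def IsQuasiPfister (p : ℕ) {F : Type*} [Field F] {ι : Type*} [Fintype ι] (a : ι → F) : Prop :=
  ∃ (n : ℕ) (b : Fin n → F), (∀ i, b i ≠ 0) ∧ Isometric p a (pfister p b)

/-- `a` is a quasi-Pfister neighbor of the form `π`: `c·a ⊆ π` for some `c ≠ 0`
and `p · dim a > dim π`. -/
def IsNeighborOf (p : ℕ) {F : Type*} [Field F] {ι κ : Type*} [Fintype ι] [Fintype κ]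
    (a : ι → F) (π : κ → F) : Prop :=
  ∃ c : F, c ≠ 0 ∧ Subform p (fun i => c * a i) π ∧ p * Fintype.card ι > Fintype.card κ

/-- `a` is a quasi-Pfister neighbor (of some quasi-Pfister form). -/
def IsQPNeighbor (p : ℕ) {F : Type*} [Field F] {ι : Type*} [Fintype ι] (a : ι → F) : Prop :=
  ∃ (n : ℕ) (b : Fin n → F), (∀ i, b i ≠ 0) ∧ IsNeighborOf p a (pfister p b)

/-- `a` is a quasi-Pfister neighbor of codimension one of some anisotropic
quasi-Pfister form: `dim π - dim a = 1`. -/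
def IsQPNeighborCodimOne (p : ℕ) {F : Type*} [Field F] {ι : Type*} [Fintype ι]
    (a : ι → F) : Prop :=
  ∃ (n : ℕ) (b : Fin n → F), (∀ i, b i ≠ 0) ∧ Anisotropic p (pfister p b) ∧
    IsNeighborOf p a (pfister p b) ∧ Fintype.card ι + 1 = p ^ n

/-- Tensor product of diagonal forms: coefficients `aᵢ · bⱼ`. -/
def tensor (p : ℕ) {F : Type*} [CommRing F] {ι κ : Type*}
    (a : ι → F) (b : κ → F) : ι × κ → F :=
  fun ik => a ik.1 * b ik.2

/-- The set `G_F(φ) = {x ∈ F× : xφ ≃ φ} ∪ {0}` of similarity factors. -/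
def simFactors (p : ℕ) {F : Type*} [Field F] {ι : Type*} [Fintype ι] (a : ι → F) : Set F :=
  {x | x ≠ 0 ∧ Isometric p (fun i => x * a i) a} ∪ {0}

/-- `b` is the anisotropic part of `a`: `b` is anisotropic and
`a ≃ b ⊥ (m × ⟨0⟩)` for some `m`. -/
def IsAnisotropicPart (p : ℕ) {F : Type*} [Field F] {ι κ : Type*} [Fintype ι] [Fintype κ]
    (a : ι → F) (b : κ → F) : Prop :=
  Anisotropic p b ∧ ∃ m : ℕ, Isometric p a (Sum.elim b fun _ : Fin m => (0 : F))

/-- `⟪c₁,…,cₘ⟫` is (a representative of) the norm form of `a`: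
`N_F(a) = Fᵖ(c₁,…,cₘ)` and `ndeg_F(a) = pᵐ`. -/
def IsNormForm (p : ℕ) {F : Type*} [Field F] {ι : Type*} [Fintype ι] (a : ι → F)
    {m : ℕ} (c : Fin m → F) : Prop :=
  normField p a = adjoin p (Set.range c) ∧ ndeg p a = p ^ m

end QLF


namespace QLF

/-- The quotients of nonzero elements of `S`. -/
def quotients {F : Type*} [Field F] (S : Set F) : Set F :=
  {z : F | ∃ u ∈ S, ∃ v ∈ S, u ≠ 0 ∧ v ≠ 0 ∧ z = u / v}

/-- Every wedge `f ∧ g` of functionals on `W` factors through the product map `W × W → F`. -/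
def WedgeFactors {F : Type*} [Field F] {K : Subfield F} (W : Submodule K F) : Prop :=
  ∀ f g : W →ₗ[K] K, ∃ l : F →ₗ[K] K, ∀ x y : W, l ((x : F) * y) = f x * g y + f y * g x

section Products

variable {F : Type*} [Field F] {K : Subfield F}

/-- The product of the `b i` over a subset of the index set. -/
def monomial {n : ℕ} (b : Fin n → F) (S : Finset (Fin n)) : F := ∏ i ∈ S, b i

theorem monomial_mul (hK : ∀ x : F, x ^ 2 ∈ K) {n : ℕ} (b : Fin n → F) (S T : Finset (Fin n)) :
    monomial b S * monomial b T ∈ Submodule.span K (Set.range (monomial b)) := by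
  have h : monomial b S * monomial b T
      = (⟨_, hK (monomial b (S ∩ T))⟩ : K) • monomial b ((S ∪ T) \ (S ∩ T)) := by
    have h1 : monomial b S * monomial b T = monomial b (S ∪ T) * monomial b (S ∩ T) :=
      (Finset.prod_union_inter).symm
    have h2 : monomial b (S ∪ T) = monomial b ((S ∪ T) \ (S ∩ T)) * monomial b (S ∩ T) :=
      (Finset.prod_sdiff (Finset.inter_subset_union)).symm
    rw [h1, h2, Subfield.smul_def, smul_eq_mul]
    ring
  rw [h]
  exact Submodule.smul_mem _ _ (Submodule.subset_span ⟨_, rfl⟩)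

/-- The subfield spanned over `K` by the products of the `b i`. -/
def monomialField (hK : ∀ x : F, x ^ 2 ∈ K) {n : ℕ} (b : Fin n → F) : Subfield F where
  carrier := Submodule.span K (Set.range (monomial b))
  zero_mem' := Submodule.zero_mem _
  add_mem' := Submodule.add_mem _
  neg_mem' := Submodule.neg_mem _
  one_mem' := Submodule.subset_span ⟨∅, by simp [monomial]⟩
  mul_mem' := by
    intro x y hx hy
    have h : x * y ∈ Submodule.span K (Set.range (monomial b)) *
        Submodule.span K (Set.range (monomial b)) := Submodule.mul_mem_mul hx hy
    rw [Submodule.span_mul_span] at h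
    refine Submodule.span_le.2 ?_ h
    rintro _ ⟨_, ⟨S, rfl⟩, _, ⟨T, rfl⟩, rfl⟩
    exact monomial_mul hK b S T
  inv_mem' := by
    intro x hx
    have h : x⁻¹ = (⟨_, K.inv_mem (hK x)⟩ : K) • x := by
      by_cases h0 : x = 0
      · simp [h0]
      · rw [Subfield.smul_def, smul_eq_mul]
        field_simp
    rw [h]
    exact Submodule.smul_mem _ _ hx

theorem linearIndependent_monomial (hK : ∀ x : F, x ^ 2 ∈ K) {n : ℕ} (W : Submodule K F)
    (w : Module.Basis (Fin (n + 1)) K W)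
    (hdeg : Module.finrank K (Submodule.span K (adjoin 2 (quotients (W : Set F)) : Set F))
      = 2 ^ n) :
    LinearIndependent K (monomial fun i : Fin n => (w i.succ : F) / w 0) := by
  set b : Fin n → F := fun i => (w i.succ : F) / w 0 with hb
  have hw0 : (w 0 : F) ≠ 0 := by simpa using w.ne_zero 0
  have hW : ∀ u ∈ W, u / w 0 ∈ monomialField hK b := by
    intro u hu
    have hsum := congrArg (Subtype.val) (w.sum_repr ⟨u, hu⟩)
    simp only [AddSubmonoidClass.coe_finsetSum] at hsum
    rw [← hsum, Finset.sum_div]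
    refine sum_mem fun i _ => ?_
    have hi : (w i : F) / w 0 ∈ Submodule.span K (Set.range (monomial b)) := by
      refine Submodule.subset_span ?_
      refine Fin.cases ⟨∅, ?_⟩ (fun j => ⟨{j}, ?_⟩) i
      · simp [monomial, hw0]
      · simp [monomial, hb]
    have h2 := Submodule.smul_mem _ (w.repr ⟨u, hu⟩ i) hi
    rw [Submodule.coe_smul, Subfield.smul_def, smul_eq_mul, mul_div_assoc]
    change _ ∈ Submodule.span K (Set.range (monomial b))
    simpa [Subfield.smul_def] using h2
  have hle : adjoin 2 (quotients (W : Set F)) ≤ monomialField hK b := by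
    refine Subfield.closure_le.2 (Set.union_subset ?_ ?_)
    · rintro _ ⟨x, rfl⟩
      have h1 : (1 : F) ∈ Submodule.span K (Set.range (monomial b)) :=
        Submodule.subset_span ⟨∅, by simp [monomial]⟩
      have h2 := Submodule.smul_mem _ (⟨_, hK x⟩ : K) h1
      change _ ∈ Submodule.span K (Set.range (monomial b))
      simpa [Subfield.smul_def] using h2
    · rintro _ ⟨u, hu, v, hv, hu0, hv0, rfl⟩
      have : u / v = (u / w 0) / (v / w 0) := by field_simp
      rw [this]
      exact div_mem (hW u hu) (hW v hv)
  have := FiniteDimensional.span_of_finite K (Set.finite_range (monomial b))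
  rw [linearIndependent_iff_card_le_finrank_span, Fintype.card_finset, Fintype.card_fin, ← hdeg]
  exact Submodule.finrank_mono (Submodule.span_le.2 hle)

theorem wedgeFactors_of_finrank [CharP F 2] (hK : ∀ x : F, x ^ 2 ∈ K) (W : Submodule K F)
    [FiniteDimensional K W]
    (hdeg : Module.finrank K (Submodule.span K (adjoin 2 (quotients (W : Set F)) : Set F))
      = 2 ^ (Module.finrank K W - 1)) :
    WedgeFactors W := by
  intro f g
  obtain h0 | ⟨n, hn⟩ := Nat.eq_zero_or_eq_succ_pred (Module.finrank K W) |>.imp_right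
    fun h => (⟨_, h⟩ : ∃ n, Module.finrank K W = n + 1)
  · have := Module.finrank_zero_iff.1 h0
    refine ⟨0, fun x y => ?_⟩
    rw [Subsingleton.elim x 0]
    simp
  let w : Module.Basis (Fin (n + 1)) K W := Module.finBasisOfFinrankEq K W hn
  have hw0 : (w 0 : F) ≠ 0 := by simpa using w.ne_zero 0
  rw [hn, Nat.add_sub_cancel] at hdeg
  have hli := linearIndependent_monomial hK W w hdeg
  set b : Fin n → F := fun i => (w i.succ : F) / w 0 with hb
  have hwb : ∀ i : Fin n, (w i.succ : F) = w 0 * b i := fun i => by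
    rw [hb]; field_simp
  let k0 : K := ⟨_, hK (w 0)⟩
  have hk0 : k0 ≠ 0 := by
    intro h
    exact hw0 (pow_eq_zero_iff (two_ne_zero) |>.1 (congrArg Subtype.val h))
  let c : Fin (n + 1) → Fin (n + 1) → K := fun i j => f (w i) * g (w j) + f (w j) * g (w i)
  let v : Finset (Fin n) → K := fun S =>
    if S.card = 1 then k0⁻¹ * ∑ i ∈ S, c 0 i.succ
    else if S.card = 2 then k0⁻¹ * ∑ i ∈ S, ∑ j ∈ S, if i < j then c i.succ j.succ else 0
    else 0
  obtain ⟨l, hl⟩ := LinearMap.exists_extend ((Module.Basis.span hli).constr K v)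
  have hlv : ∀ S, l (monomial b S) = v S := by
    intro S
    have h1 := (Module.Basis.span hli).constr_basis K v S
    rw [← hl, LinearMap.comp_apply, Submodule.subtype_apply, Module.Basis.span_apply] at h1
    exact h1
  have hsq : ∀ x : F, l (x * x) = 0 := by
    intro x
    have h1 : x * x = (⟨_, hK x⟩ : K) • monomial b ∅ := by
      simp [monomial, Subfield.smul_def, sq]
    rw [h1, map_smul, hlv]
    simp [v]
  have hcomm : ∀ i j, c i j = c j i := fun i j => add_comm _ _
  have hlt : ∀ i j, i < j → l ((w i : F) * w j) = c i j := by
    intro i j hij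
    obtain ⟨j, rfl⟩ := Fin.exists_succ_eq.2 (Fin.ne_zero_of_lt hij)
    obtain rfl | ⟨i, rfl⟩ := Fin.eq_zero_or_eq_succ i
    · have h1 : (w 0 : F) * w j.succ = k0 • monomial b {j} := by
        simp only [monomial, Finset.prod_singleton, hwb, Subfield.smul_def, k0, smul_eq_mul]
        ring
      rw [h1, map_smul, hlv]
      simp [v, hk0]
    · have hij' : i < j := Fin.succ_lt_succ_iff.1 hij
      have h1 : (w i.succ : F) * w j.succ = k0 • monomial b {i, j} := by
        simp only [monomial, Finset.prod_pair hij'.ne, hwb, Subfield.smul_def, k0, smul_eq_mul]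
        ring
      rw [h1, map_smul, hlv]
      simp [v, hk0, Finset.card_pair hij'.ne, Finset.sum_pair hij'.ne, hij', hij'.not_gt]
  let P : W →ₗ[K] W →ₗ[K] K :=
    LinearMap.mk₂ K (fun x y => l ((x : F) * y))
      (by intros; simp [add_mul]) (by intros; simp)
      (by intros; simp [mul_add]) (by intros; simp)
  let Q : W →ₗ[K] W →ₗ[K] K :=
    LinearMap.mk₂ K (fun x y => f x * g y + f y * g x)
      (by intros; simp; ring) (by intros; simp; ring)
      (by intros; simp; ring) (by intros; simp; ring)
  have hPQ : P = Q := by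
    refine w.ext fun i => w.ext fun j => ?_
    change l ((w i : F) * w j) = c i j
    rcases lt_trichotomy i j with hij | rfl | hij
    · exact hlt i j hij
    · rw [hsq]
      exact (CharTwo.add_self_eq_zero _).symm
    · rw [mul_comm, hlt j i hij, hcomm]
  exact ⟨l, fun x y => congrArg (fun R : W →ₗ[K] W →ₗ[K] K => R x y) hPQ⟩

/-- For linearly independent `w i`, the bivector `w 0 ∧ w 1 + w 2 ∧ w 3` violates the Plücker
relation, so the corresponding sum of products is not a product of two elements. -/
theorem not_linearIndependent_of_mul_add_mul [CharP F 2] {W : Submodule K F} (hW : WedgeFactors W)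
    (w : Fin 4 → W) (x y : W) (h : (w 0 : F) * w 1 + w 2 * w 3 = x * y) :
    ¬ LinearIndependent K w := by
  intro hw
  obtain ⟨f, hf⟩ := LinearMap.exists_extend
    ((Module.Basis.span hw).constr K fun i => (Pi.single i 1 : Fin 4 → K))
  have hfw : ∀ i j, f (w i) j = (Pi.single i 1 : Fin 4 → K) j := by
    intro i j
    have h1 := (Module.Basis.span hw).constr_basis K (fun i => (Pi.single i 1 : Fin 4 → K)) i
    rw [← hf, LinearMap.comp_apply, Submodule.subtype_apply, Module.Basis.span_apply] at h1
    rw [h1]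
  have key : ∀ i j, f (w 0) i * f (w 1) j + f (w 1) i * f (w 0) j
      + (f (w 2) i * f (w 3) j + f (w 3) i * f (w 2) j) = f x i * f y j + f y i * f x j := by
    intro i j
    obtain ⟨l, hl⟩ := hW (LinearMap.proj i ∘ₗ f) (LinearMap.proj j ∘ₗ f)
    have h1 := congrArg l h
    rw [map_add, hl, hl, hl] at h1
    simpa using h1
  have h01 := key 0 1
  have h23 := key 2 3
  have h02 := key 0 2
  have h13 := key 1 3
  have h03 := key 0 3
  have h12 := key 1 2
  simp [hfw] at h01 h23 h02 h13 h03 h12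
  have two : (2 : K) = 0 := CharTwo.two_eq_zero
  have : (1 : K) = 0 := by
    linear_combination h01 + (f x 0 * f y 1 + f y 0 * f x 1) * h23
      + (f x 1 * f y 3 + f y 1 * f x 3) * h02 + (f x 1 * f y 2 + f y 1 * f x 2) * h03
      + (f x 0 * f x 1 * f y 2 * f y 3 + f x 0 * f x 2 * f y 1 * f y 3
        + f x 0 * f x 3 * f y 1 * f y 2 + f x 1 * f x 2 * f y 0 * f y 3
        + f x 1 * f x 3 * f y 0 * f y 2 + f x 2 * f x 3 * f y 0 * f y 1) * two
  exact one_ne_zero this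

theorem exists_mul_eq (hK : ∀ x : F, x ^ 2 ∈ K) {W : Submodule K F} {u w₁ w₂ : F} (c₁ c₂ : K)
    (hw₁ : w₁ ∈ W) (hw₂ : w₂ ∈ W) (hu : u = c₁ * w₁ + c₂ * w₂) (hu0 : u ≠ 0) :
    ∃ z ∈ W, w₁ * w₂ = u * z := by
  have huW : u ∈ W := by
    rw [hu]
    exact W.add_mem (W.smul_mem c₁ hw₁) (W.smul_mem c₂ hw₂)
  have hsq : ∀ k ∈ K, ∀ w ∈ W, k * w ∈ W := fun k hk w hw => W.smul_mem (⟨k, hk⟩ : K) hw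
  by_cases h : (c₁ : F) = 0
  · have h2 : (c₂ : F) ≠ 0 := by
      rintro h2
      simp [hu, h, h2] at hu0
    refine ⟨_, hsq _ (K.inv_mem c₂.2) _ hw₁, ?_⟩
    rw [hu, h]
    field_simp
    ring
  · refine ⟨_, W.sub_mem (hsq _ (K.inv_mem c₁.2) _ hw₂)
      (hsq _ (K.mul_mem (K.mul_mem c₂.2 (K.inv_mem c₁.2))
        (K.mul_mem (hK w₂) (K.inv_mem (hK u)))) _ huW), ?_⟩
    field_simp
    rw [hu]
    ring

theorem exists_common [CharP F 2] (hK : ∀ x : F, x ^ 2 ∈ K) {W : Submodule K F}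
    (hW : WedgeFactors W) {w₁ w₂ w₃ w₄ x y : F} (h₁ : w₁ ∈ W) (h₂ : w₂ ∈ W) (h₃ : w₃ ∈ W)
    (h₄ : w₄ ∈ W) (hx : x ∈ W) (hy : y ∈ W) (h : w₁ * w₂ + w₃ * w₄ = x * y)
    (h₁₂ : w₁ * w₂ ∉ K) (h₃₄ : w₃ * w₄ ∉ K) :
    ∃ c₁ c₂ c₃ c₄ : K, (c₁ : F) * w₁ + c₂ * w₂ = c₃ * w₃ + c₄ * w₄ ∧
      (c₁ : F) * w₁ + c₂ * w₂ ≠ 0 := by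
  have indep : ∀ {a b : F} (c d : K), a * b ∉ K → (c : F) * a + d * b = 0 → c = 0 ∧ d = 0 := by
    intro a b c d hab hcd
    have hc : c = 0 := by
      by_contra hc
      have hc' : (c : F) ≠ 0 := by simpa using hc
      refine hab ?_
      have : a * b = -d * (c : F)⁻¹ * b ^ 2 := by
        field_simp
        linear_combination b * hcd
      rw [this]
      exact K.mul_mem (K.mul_mem (K.neg_mem d.2) (K.inv_mem c.2)) (hK b)
    refine ⟨hc, ?_⟩
    have hb : b ≠ 0 := by
      rintro rfl
      exact hab (by simp)
    simpa [hc, hb] using hcd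
  have hli := not_linearIndependent_of_mul_add_mul hW
    ![⟨w₁, h₁⟩, ⟨w₂, h₂⟩, ⟨w₃, h₃⟩, ⟨w₄, h₄⟩] ⟨x, hx⟩ ⟨y, hy⟩ (by simpa using h)
  obtain ⟨c, hc, i, hi⟩ := Fintype.not_linearIndependent_iff.1 hli
  have hc' := congrArg Subtype.val hc
  simp [Fin.sum_univ_four, Subfield.smul_def] at hc'
  refine ⟨c 0, c 1, -c 2, -c 3, ?_, fun h0 => ?_⟩
  · push_cast
    linear_combination hc'
  · obtain ⟨e0, e1⟩ := indep _ _ h₁₂ h0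
    obtain ⟨e2, e3⟩ := indep (c 2) (c 3) h₃₄ (by linear_combination hc' - h0)
    fin_cases i <;> simp_all

theorem mem_of_relation [CharP F 2] {V : Submodule K F} (hV : WedgeFactors V) {a₁ a₂ a₃ : F}
    (h1 : (1 : F) ∈ V) (ha₁ : a₁ ∈ V) (ha₂ : a₂ ∈ V) (ha₃ : a₃ ∈ V)
    (hli : LinearIndependent K ![(1 : F), a₁, a₂]) (k₀ k₁ k₂ k₃ k₄ : K)
    (h : (k₀ : F) + k₁ * a₁ + k₂ * a₂ + k₃ * (a₁ * a₂) + k₄ * a₃ = 0) : k₃ = 0 := by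
  obtain ⟨a, rfl⟩ : ∃ a : V, (a : F) = a₃ := ⟨⟨a₃, ha₃⟩, rfl⟩
  let v : Fin 3 → V := ![⟨1, h1⟩, ⟨a₁, ha₁⟩, ⟨a₂, ha₂⟩]
  have hv : LinearIndependent K v := by
    refine LinearIndependent.of_comp V.subtype ?_
    convert hli using 1
    ext i
    fin_cases i <;> rfl
  obtain ⟨f, hf⟩ := LinearMap.exists_extend
    ((Module.Basis.span hv).constr K fun i => (Pi.single i 1 : Fin 3 → K))
  have hfv : ∀ i j, f (v i) j = (Pi.single i 1 : Fin 3 → K) j := by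
    intro i j
    have h1 := (Module.Basis.span hv).constr_basis K (fun i => (Pi.single i 1 : Fin 3 → K)) i
    rw [← hf, LinearMap.comp_apply, Submodule.subtype_apply, Module.Basis.span_apply] at h1
    rw [h1]
  obtain ⟨l, hl⟩ := hV (LinearMap.proj 1 ∘ₗ f) (LinearMap.proj 2 ∘ₗ f)
  have e : k₀ • ((v 0 : F) * v 0) + k₁ • ((v 1 : F) * v 0) + k₂ • ((v 2 : F) * v 0)
      + k₃ • ((v 1 : F) * v 2) + k₄ • ((a : F) * v 0) = 0 := by
    simpa [v, Subfield.smul_def] using h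
  have h2 := congrArg l e
  simp only [map_add, map_smul, hl, map_zero] at h2
  simpa [hfv, Pi.single_apply] using h2

theorem exists_le_mul [CharP F 2] (hK : ∀ x : F, x ^ 2 ∈ K) {V W : Submodule K F}
    (hV : WedgeFactors V) (hW : WedgeFactors W) (h1 : (1 : F) ∈ V) (hW0 : W ≠ ⊥)
    (hprod : ∀ a ∈ V, ∃ x ∈ W, ∃ y ∈ W, a = x * y) :
    ∃ u : F, u ≠ 0 ∧ ∀ a ∈ V, ∃ z ∈ W, a = u * z := by
  have hscal : ∀ u ∈ W, u ≠ 0 → ∀ a ∈ K, ∃ z ∈ W, a = u * z := by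
    intro u hu hu0 a ha
    refine ⟨_, W.smul_mem (⟨_, K.mul_mem ha (K.inv_mem (hK u))⟩ : K) hu, ?_⟩
    rw [Subfield.smul_def, smul_eq_mul]
    field_simp
  by_cases hVK : ∀ a ∈ V, a ∈ K
  · obtain ⟨u, hu, hu0⟩ := W.ne_bot_iff.1 hW0
    exact ⟨u, hu0, fun a ha => hscal u hu hu0 a (hVK a ha)⟩
  push Not at hVK
  obtain ⟨a₁, ha₁, ha₁K⟩ := hVK
  obtain ⟨w₁, hw₁, w₂, hw₂, ha₁w⟩ := hprod a₁ ha₁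
  have hw₁0 : w₁ ≠ 0 := by
    rintro rfl
    exact ha₁K (by simp [ha₁w])
  by_cases hV1 : ∀ a ∈ V, ∃ c d : K, a = c + d * a₁
  · refine ⟨w₁, hw₁0, fun a ha => ?_⟩
    obtain ⟨c, d, rfl⟩ := hV1 a ha
    obtain ⟨z, hz, hcz⟩ := hscal w₁ hw₁ hw₁0 c c.2
    refine ⟨z + d * w₂, W.add_mem hz (W.smul_mem d hw₂), ?_⟩
    rw [ha₁w, hcz]
    ring
  push Not at hV1
  obtain ⟨a₂, ha₂, ha₂K⟩ := hV1
  have hli : LinearIndependent K ![(1 : F), a₁, a₂] := by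
    rw [Fintype.linearIndependent_iff]
    intro c hc
    simp [Fin.sum_univ_three, Subfield.smul_def] at hc
    have h2 : c 2 = 0 := by
      by_contra h2
      have h2' : (c 2 : F) ≠ 0 := by simpa using h2
      refine ha₂K (-c 0 / c 2) (-c 1 / c 2) ?_
      push_cast
      field_simp
      linear_combination hc
    have h1 : c 1 = 0 := by
      by_contra h1
      have h1' : (c 1 : F) ≠ 0 := by simpa using h1
      refine ha₁K ?_
      have : a₁ = ((-c 0 / c 1 : K) : F) := by
        push_cast
        field_simp
        simp only [h2, ZeroMemClass.coe_zero] at hc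
        linear_combination hc
      rw [this]
      exact SetLike.coe_mem _
    have h0 : c 0 = 0 := by simpa [h1, h2] using hc
    intro i
    fin_cases i <;> assumption
  have ha₂K' : a₂ ∉ K := fun h => ha₂K ⟨a₂, h⟩ 0 (by simp)
  have common : ∀ {x y z t : F}, x ∈ W → y ∈ W → z ∈ W → t ∈ W → x * y ∈ V → z * t ∈ V →
      x * y ∉ K → z * t ∉ K → ∃ c₁ c₂ c₃ c₄ : K, (c₁ : F) * x + c₂ * y = c₃ * z + c₄ * t ∧
      (c₁ : F) * x + c₂ * y ≠ 0 := by
    intro x y z t hx hy hz ht hxy hzt hxy' hzt'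
    obtain ⟨p, hp, q, hq, hpq⟩ := hprod _ (V.add_mem hxy hzt)
    exact exists_common hK hW hx hy hz ht hp hq hpq hxy' hzt'
  obtain ⟨w₃, hw₃, w₄, hw₄, ha₂w⟩ := hprod a₂ ha₂
  obtain ⟨c₁, c₂, c₃, c₄, hc, hc0⟩ := common hw₁ hw₂ hw₃ hw₄ (ha₁w ▸ ha₁) (ha₂w ▸ ha₂)
    (ha₁w ▸ ha₁K) (ha₂w ▸ ha₂K')
  have huW : (c₁ : F) * w₁ + c₂ * w₂ ∈ W := W.add_mem (W.smul_mem c₁ hw₁) (W.smul_mem c₂ hw₂)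
  obtain ⟨b₁, hb₁, hab₁⟩ := exists_mul_eq hK c₁ c₂ hw₁ hw₂ rfl hc0
  obtain ⟨b₂, hb₂, hab₂⟩ := exists_mul_eq hK c₃ c₄ hw₃ hw₄ hc hc0
  rw [← ha₁w] at hab₁
  rw [← ha₂w] at hab₂
  generalize (c₁ : F) * w₁ + c₂ * w₂ = u at *
  refine ⟨u, hc0, fun a ha => ?_⟩
  by_cases haK : a ∈ K
  · exact hscal u huW hc0 a haK
  obtain ⟨x, hx, y, hy, rfl⟩ := hprod a ha
  obtain ⟨α, β, γ, δ, e₁, e₁0⟩ := common huW hb₁ hx hy (hab₁ ▸ ha₁) ha (hab₁ ▸ ha₁K) haK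
  obtain ⟨α', β', γ', δ', e₂, e₂0⟩ := common huW hb₂ hx hy (hab₂ ▸ ha₂) ha (hab₂ ▸ ha₂K') haK
  have done : ∀ {α β γ δ : K} {b : F}, (α : F) * u + β * b = γ * x + δ * y →
      (α : F) * u + β * b ≠ 0 → β = 0 → ∃ z ∈ W, x * y = u * z := by
    intro α β γ δ b h h0 hβ
    simp only [hβ, ZeroMemClass.coe_zero, zero_mul, add_zero] at h h0
    have hα : (α : F) ≠ 0 := left_ne_zero_of_mul h0
    refine exists_mul_eq hK (γ / α) (δ / α) hx hy ?_ hc0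
    push_cast
    field_simp
    linear_combination h
  by_cases hβ : β = 0
  · exact done e₁ e₁0 hβ
  by_cases hβ' : β' = 0
  · exact done e₂ e₂0 hβ'
  exfalso
  let U : K := ⟨_, hK u⟩
  have hU : (U : F) = u ^ 2 := rfl
  let X : K := ⟨_, hK x⟩
  have hX : (X : F) = x ^ 2 := rfl
  let Y : K := ⟨_, hK y⟩
  have hY : (Y : F) = y ^ 2 := rfl
  have hUne : U ≠ 0 := fun h => hc0 (by simpa [U] using congrArg Subtype.val h)
  have h0 := mem_of_relation hV h1 ha₁ ha₂ ha hli
    (α * α' * U - γ * γ' * X - δ * δ' * Y) (α' * β) (α * β') (β * β' / U)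
    (-(γ * δ' + γ' * δ)) (by
      push_cast
      rw [hU, hX, hY, hab₁, hab₂]
      field_simp
      linear_combination (α' * u + β' * b₂) * e₁ + (γ * x + δ * y) * e₂)
  simp [hβ, hβ', hUne] at h0

theorem finrank_map_mulLeft {K : Subfield F} (V : Submodule K F) {c : F} (hc : c ≠ 0) :
    Module.finrank K (V.map (LinearMap.mulLeft K c)) = Module.finrank K V :=
  (V.equivMapOfInjective (LinearMap.mulLeft K c) fun _ _ h => mul_left_cancel₀ hc h).finrank_eq.symm

theorem mem_quotients_iff {K : Subfield F} (V : Submodule K F)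
    [FiniteDimensional K V] {x : F} (hx : x ≠ 0) :
    x ∈ quotients (V : Set F) ↔
      Module.finrank K (V ⊔ V.map (LinearMap.mulLeft K x) : Submodule K F)
        ≠ 2 * Module.finrank K V := by
  have hsum := Submodule.finrank_sup_add_finrank_inf_eq V (V.map (LinearMap.mulLeft K x))
  rw [finrank_map_mulLeft _ hx] at hsum
  have hinf : Module.finrank K (V ⊓ V.map (LinearMap.mulLeft K x) : Submodule K F) ≠ 0 ↔
      x ∈ quotients (V : Set F) := by
    rw [Ne, Submodule.finrank_eq_zero, ← Ne, Submodule.ne_bot_iff]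
    constructor
    · rintro ⟨_, ⟨hv, w, hw, rfl⟩, h0⟩
      rw [LinearMap.mulLeft_apply] at hv h0
      have hw0 : w ≠ 0 := right_ne_zero_of_mul h0
      exact ⟨_, hv, w, hw, h0, hw0, by field_simp⟩
    · rintro ⟨v, hv, w, hw, hv0, hw0, rfl⟩
      exact ⟨v, ⟨hv, w, hw, by rw [LinearMap.mulLeft_apply]; field_simp⟩, hv0⟩
  rw [← hinf]
  omega

theorem zero_notMem_quotients (S : Set F) : (0 : F) ∉ quotients S := by
  rintro ⟨u, -, v, -, hu, hv, h⟩
  exact div_ne_zero hu hv h.symm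

theorem quotients_map_mulLeft {K : Subfield F} (V : Submodule K F) {c : F} (hc : c ≠ 0) :
    quotients (V.map (LinearMap.mulLeft K c) : Set F) = quotients (V : Set F) := by
  ext z
  constructor
  · rintro ⟨_, ⟨u, hu, rfl⟩, _, ⟨v, hv, rfl⟩, hu0, hv0, rfl⟩
    refine ⟨u, hu, v, hv, right_ne_zero_of_mul hu0, right_ne_zero_of_mul hv0, ?_⟩
    exact mul_div_mul_left u v hc
  · rintro ⟨u, hu, v, hv, hu0, hv0, rfl⟩
    refine ⟨_, ⟨u, hu, rfl⟩, _, ⟨v, hv, rfl⟩, mul_ne_zero hc hu0, mul_ne_zero hc hv0, ?_⟩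
    exact (mul_div_mul_left u v hc).symm

theorem exists_eq_map_mulLeft [CharP F 2] {K : Subfield F} (hK : ∀ x : F, x ^ 2 ∈ K)
    (V W : Submodule K F) [FiniteDimensional K V] [FiniteDimensional K W]
    (hdim : Module.finrank K V = Module.finrank K W)
    (hquot : quotients (V : Set F) = quotients (W : Set F))
    (hdeg : Module.finrank K (Submodule.span K (adjoin 2 (quotients (V : Set F)) : Set F))
      = 2 ^ (Module.finrank K V - 1)) :
    ∃ c : F, c ≠ 0 ∧ V = W.map (LinearMap.mulLeft K c) := by
  by_cases hV0 : V = ⊥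
  · have hW0 : W = ⊥ := by
      rw [← Submodule.finrank_eq_zero, ← hdim, hV0, finrank_bot]
    exact ⟨1, one_ne_zero, by simp [hV0, hW0]⟩
  have hW0 : W ≠ ⊥ := by
    rwa [Ne, ← Submodule.finrank_eq_zero, ← hdim, Submodule.finrank_eq_zero]
  obtain ⟨v, hv, hv0⟩ := V.ne_bot_iff.1 hV0
  have hvi := inv_ne_zero hv0
  have hV' : WedgeFactors (V.map (LinearMap.mulLeft K v⁻¹)) := by
    refine wedgeFactors_of_finrank hK _ ?_
    rw [quotients_map_mulLeft V hvi, hdeg, finrank_map_mulLeft _ hvi]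
  have hW : WedgeFactors W := wedgeFactors_of_finrank hK _ (by rw [← hquot, hdeg, hdim])
  have h1 : (1 : F) ∈ V.map (LinearMap.mulLeft K v⁻¹) := ⟨v, hv, inv_mul_cancel₀ hv0⟩
  have hprod : ∀ a ∈ V.map (LinearMap.mulLeft K v⁻¹), ∃ x ∈ W, ∃ y ∈ W, a = x * y := by
    intro a ha
    by_cases ha0 : a = 0
    · exact ⟨0, zero_mem _, 0, zero_mem _, by simp [ha0]⟩
    have hq : a ∈ quotients (W : Set F) := by
      rw [← hquot, ← quotients_map_mulLeft V hvi]
      exact ⟨a, ha, 1, h1, ha0, one_ne_zero, by simp⟩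
    obtain ⟨x, hx, y, hy, hx0, hy0, rfl⟩ := hq
    refine ⟨x, hx, _, W.smul_mem (⟨_, K.inv_mem (hK y)⟩ : K) hy, ?_⟩
    rw [Subfield.smul_def, smul_eq_mul]
    field_simp
  obtain ⟨u, hu0, hu⟩ := exists_le_mul hK hV' hW h1 hW0 hprod
  have hc : v * u ≠ 0 := mul_ne_zero hv0 hu0
  refine ⟨v * u, hc, Submodule.eq_of_le_of_finrank_eq ?_ ?_⟩
  · intro a ha
    obtain ⟨z, hz, haz⟩ := hu _ ⟨a, ha, rfl⟩
    refine ⟨z, hz, ?_⟩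
    rw [LinearMap.mulLeft_apply] at haz ⊢
    rw [mul_assoc, ← haz, mul_inv_cancel_left₀ hv0]
  · rw [finrank_map_mulLeft _ hc, hdim]

end Products

section Values

theorem values_eq_of_isAnisotropicPart {F ι κ : Type*} [Field F] [Fintype ι] [Fintype κ] {a : ι → F}
    {b : κ → F} (h : IsAnisotropicPart 2 a b) : values 2 a = values 2 b := by
  obtain ⟨-, m, T, hT⟩ := h
  have hsum : ∀ y : κ ⊕ Fin m → F, eval 2 (Sum.elim b fun _ : Fin m => (0 : F)) y
      = eval 2 b (fun i => y (Sum.inl i)) := by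
    intro y
    simp [eval, Fintype.sum_sum_type]
  ext z
  constructor
  · rintro ⟨x, rfl⟩
    exact ⟨fun i => T x (Sum.inl i), by rw [hT, hsum]⟩
  · rintro ⟨y, rfl⟩
    exact ⟨T.symm (Sum.elim y 0), by rw [hT, hsum]; simp⟩

theorem exists_equiv_of_range_eq {K V M : Type*} [Field K] [AddCommGroup V] [Module K V]
    [FiniteDimensional K V] {V' : Type*} [AddCommGroup V'] [Module K V'] [FiniteDimensional K V']
    [AddCommGroup M] [Module K M] (f : V →ₗ[K] M) (g : V' →ₗ[K] M)
    (hdim : Module.finrank K V = Module.finrank K V') (h : f.range = g.range) :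
    ∃ T : V ≃ₗ[K] V', ∀ x, f x = g (T x) := by
  obtain ⟨C, hC⟩ := Submodule.exists_isCompl f.ker
  obtain ⟨D, hD⟩ := Submodule.exists_isCompl g.ker
  have hr1 := f.finrank_range_add_finrank_ker
  have hr2 := g.finrank_range_add_finrank_ker
  rw [h] at hr1
  let e₁ : f.ker ≃ₗ[K] g.ker := LinearEquiv.ofFinrankEq _ _ (by omega)
  let e₂ : C ≃ₗ[K] D := (Submodule.quotientEquivOfIsCompl _ _ hC).symm ≪≫ₗ f.quotKerEquivRange
    ≪≫ₗ LinearEquiv.ofEq _ _ h ≪≫ₗ g.quotKerEquivRange.symm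
    ≪≫ₗ Submodule.quotientEquivOfIsCompl _ _ hD
  have he₂ : ∀ c : C, g (e₂ c) = f c := by
    intro c
    have h1 : (g.quotKerEquivRange ((Submodule.quotientEquivOfIsCompl _ _ hD).symm (e₂ c)) : M)
        = f c := by
      simp [e₂]
    rwa [Submodule.quotientEquivOfIsCompl_symm_apply, LinearMap.quotKerEquivRange_apply_mk] at h1
  refine ⟨(Submodule.prodEquivOfIsCompl _ _ hC).symm ≪≫ₗ LinearEquiv.prodCongr e₁ e₂ ≪≫ₗ
    Submodule.prodEquivOfIsCompl _ _ hD, fun x => ?_⟩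
  obtain ⟨⟨k, c⟩, rfl⟩ := (Submodule.prodEquivOfIsCompl _ _ hC).surjective x
  have hk : f k = 0 := k.2
  have hk' : g (e₁ k) = 0 := (e₁ k).2
  simp [hk, hk', he₂]

variable {F : Type*} [Field F] [CharP F 2]

theorem mem_pthSubfield {y : F} : y ∈ pthSubfield 2 F ↔ ∃ x : F, x ^ 2 = y := by
  have : Fact (Nat.Prime 2) := ⟨Nat.prime_two⟩
  refine ⟨fun h => ?_, fun h => Subfield.subset_closure h⟩
  have hle : pthSubfield 2 F ≤ (frobenius F 2).fieldRange :=
    Subfield.closure_le.2 (by rintro _ ⟨x, rfl⟩; exact ⟨x, rfl⟩)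
  exact hle h

theorem sq_mem (x : F) : x ^ 2 ∈ pthSubfield 2 F := mem_pthSubfield.2 ⟨x, rfl⟩

/-- The square map as an isomorphism of `F` with its subfield of squares. -/
noncomputable def sqEquiv (F : Type*) [Field F] [CharP F 2] : F ≃+* pthSubfield 2 F :=
  haveI : Fact (Nat.Prime 2) := ⟨Nat.prime_two⟩
  RingEquiv.ofBijective ((frobenius F 2).codRestrict (pthSubfield 2 F) sq_mem)
    ⟨RingHom.injective _, fun y => by
      obtain ⟨x, hx⟩ := mem_pthSubfield.1 y.2
      exact ⟨x, Subtype.ext hx⟩⟩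

theorem coe_sqEquiv (x : F) : (sqEquiv F x : F) = x ^ 2 := rfl

/-- The span of the coefficients of a form over the field of squares. -/
def valueSpan {ι : Type*} (a : ι → F) : Submodule (pthSubfield 2 F) F :=
  Submodule.span _ (Set.range a)

instance {ι : Type*} [Finite ι] (a : ι → F) : FiniteDimensional (pthSubfield 2 F) (valueSpan a) :=
  FiniteDimensional.span_of_finite _ (Set.finite_range a)

theorem linearCombination_sqEquiv {ι : Type*} [Fintype ι] (a x : ι → F) :
    Fintype.linearCombination (pthSubfield 2 F) a (fun i => sqEquiv F (x i)) = eval 2 a x := by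
  simp [Fintype.linearCombination_apply, eval, Subfield.smul_def, coe_sqEquiv, mul_comm]

theorem values_eq {ι : Type*} [Fintype ι] (a : ι → F) :
    values 2 a = (valueSpan a : Set F) := by
  rw [valueSpan, ← Fintype.range_linearCombination]
  ext z
  constructor
  · rintro ⟨x, rfl⟩
    exact ⟨_, linearCombination_sqEquiv a x⟩
  · rintro ⟨x, rfl⟩
    refine ⟨fun i => (sqEquiv F).symm (x i), ?_⟩
    rw [← linearCombination_sqEquiv]
    simp

theorem finrank_valueSpan_of_anisotropic {ι : Type*} [Fintype ι] {a : ι → F}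
    (ha : Anisotropic 2 a) :
    Module.finrank (pthSubfield 2 F) (valueSpan a) = Fintype.card ι := by
  refine finrank_span_eq_card ?_
  rw [Fintype.linearIndependent_iff]
  by_contra! h
  obtain ⟨x, hx, i, hi⟩ := h
  refine ha ⟨fun i => (sqEquiv F).symm (x i), fun h0 => hi ?_, ?_⟩
  · simpa using congrFun h0 i
  · rw [← linearCombination_sqEquiv, ← hx]
    simp [Fintype.linearCombination_apply]

theorem degree_eq_of_minimal {ι κ : Type*} [Fintype ι] [Fintype κ] {a : ι → F}
    {b : κ → F} (h : IsAnisotropicPart 2 a b) (hb : Minimal 2 b) :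
    Module.finrank (pthSubfield 2 F) (Submodule.span (pthSubfield 2 F)
      (adjoin 2 (quotients (valueSpan a : Set F)) : Set F))
      = 2 ^ (Module.finrank (pthSubfield 2 F) (valueSpan a) - 1) := by
  have hv := values_eq_of_isAnisotropicPart h
  have hab : valueSpan a = valueSpan b :=
    SetLike.coe_injective (by rw [← values_eq, ← values_eq, hv])
  rw [hab, finrank_valueSpan_of_anisotropic hb.1, ← hb.2, ← values_eq]
  rfl

theorem isometric_of_valueSpan_eq {ι κ : Type*} [Fintype ι] [Fintype κ] (a : ι → F) (b : κ → F)
    (hcard : Fintype.card ι = Fintype.card κ) (h : valueSpan a = valueSpan b) :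
    Isometric 2 a b := by
  obtain ⟨T, hT⟩ := exists_equiv_of_range_eq (Fintype.linearCombination (pthSubfield 2 F) a)
    (Fintype.linearCombination (pthSubfield 2 F) b) (by simpa using hcard)
    (by rwa [Fintype.range_linearCombination, Fintype.range_linearCombination])
  let σ := sqEquiv F
  refine ⟨{ toFun := fun x i => σ.symm (T (fun j => σ (x j)) i)
            invFun := fun y i => σ.symm (T.symm (fun j => σ (y j)) i)
            map_add' := ?_, map_smul' := ?_, left_inv := ?_, right_inv := ?_ }, ?_⟩
  · intro x y
    have h1 : (fun j => σ ((x + y) j)) = (fun j => σ (x j)) + fun j => σ (y j) := by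
      ext; simp
    ext i
    rw [h1, map_add]
    simp
  · intro c x
    have h1 : (fun j => σ ((c • x) j)) = σ c • fun j => σ (x j) := by
      ext; simp
    ext i
    rw [h1, map_smul]
    simp
  · intro x
    simp
  · intro x
    simp
  · intro x
    rw [← linearCombination_sqEquiv a, hT, ← linearCombination_sqEquiv b]
    simp [σ]

end Values

section Defects

variable {F : Type u} [Field F] [CharP F 2]

/-- The extension `K(x)` of the field `K` of squares, all of whose elements are `a + b x`. -/
def squareExt (x : F) : Subfield F where
  carrier := {z | ∃ a ∈ pthSubfield 2 F, ∃ b ∈ pthSubfield 2 F, z = a + b * x}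
  zero_mem' := ⟨0, zero_mem _, 0, zero_mem _, by simp⟩
  one_mem' := ⟨1, one_mem _, 0, zero_mem _, by simp⟩
  add_mem' := by
    rintro _ _ ⟨a, ha, b, hb, rfl⟩ ⟨c, hc, d, hd, rfl⟩
    exact ⟨_, add_mem ha hc, _, add_mem hb hd, by ring⟩
  neg_mem' := by
    rintro _ ⟨a, ha, b, hb, rfl⟩
    exact ⟨_, neg_mem ha, _, neg_mem hb, by ring⟩
  mul_mem' := by
    rintro _ _ ⟨a, ha, b, hb, rfl⟩ ⟨c, hc, d, hd, rfl⟩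
    exact ⟨_, add_mem (mul_mem ha hc) (mul_mem (mul_mem hb hd) (sq_mem x)), _,
      add_mem (mul_mem ha hd) (mul_mem hb hc), by ring⟩
  inv_mem' := by
    rintro _ ⟨a, ha, b, hb, rfl⟩
    have hs := inv_mem (sq_mem (a + b * x))
    refine ⟨_, mul_mem ha hs, _, mul_mem hb hs, ?_⟩
    by_cases h0 : a + b * x = 0
    · simp [h0]
    · field_simp

theorem mem_squareExt (x : F) : x ∈ squareExt x :=
  ⟨0, zero_mem _, 1, one_mem _, by simp⟩

theorem pthSubfield_le_squareExt (x : F) : pthSubfield 2 F ≤ squareExt x :=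
  fun a ha => ⟨a, ha, 0, zero_mem _, by simp⟩

/-- The square map from `F` to `K(x)`, isomorphic to the inclusion of `F` in `F(√x)`. -/
def toSquareExt [Fact (Nat.Prime 2)] (x : F) : F →+* squareExt x :=
  (frobenius F 2).codRestrict (squareExt x) fun y => pthSubfield_le_squareExt x (sq_mem y)

theorem closure_toSquareExt [Fact (Nat.Prime 2)] (x : F) :
    Subfield.closure (insert (⟨x, mem_squareExt x⟩ : squareExt x) (Set.range (toSquareExt x)))
      = ⊤ := by
  rw [eq_top_iff]
  rintro ⟨_, _, ha, _, hb, rfl⟩ -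
  obtain ⟨a, rfl⟩ := mem_pthSubfield.1 ha
  obtain ⟨b, rfl⟩ := mem_pthSubfield.1 hb
  have hmem : ∀ y, toSquareExt x y ∈ Subfield.closure
      (insert (⟨x, mem_squareExt x⟩ : squareExt x) (Set.range (toSquareExt x))) :=
    fun y => Subfield.subset_closure (Set.mem_insert_of_mem _ ⟨y, rfl⟩)
  exact add_mem (hmem a) (mul_mem (hmem b) (Subfield.subset_closure (Set.mem_insert _ _)))

theorem finrank_add_defect [Fact (Nat.Prime 2)] {ι : Type*} [Fintype ι] (a : ι → F) (x : F) :
    Module.finrank (squareExt x) (Submodule.span (squareExt x) (Set.range a))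
      + defect 2 (toSquareExt x ∘ a) = Fintype.card ι := by
  have hker : zeroSubmodule 2 (toSquareExt x ∘ a)
      = (Fintype.linearCombination (squareExt x) a).ker := by
    ext z
    rw [LinearMap.mem_ker]
    change eval 2 (fun i => toSquareExt x (a i)) z = 0 ↔ _
    have h1 : ((eval 2 (fun i => toSquareExt x (a i)) z : squareExt x) : F)
        = (Fintype.linearCombination (squareExt x) a z) ^ 2 := by
      change _ = frobenius F 2 _
      rw [Fintype.linearCombination_apply, map_sum]
      simp only [eval, AddSubmonoidClass.coe_finsetSum, Subfield.smul_def, smul_eq_mul, map_mul]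
      exact Finset.sum_congr rfl fun i _ => mul_comm _ _
    rw [← Subtype.coe_inj, h1]
    simp
  rw [defect, hker, ← Fintype.range_linearCombination,
    LinearMap.finrank_range_add_finrank_ker, Module.finrank_fintype_fun_eq_card]

theorem finrank_span_squareExt {ι : Type*} (a : ι → F) (x : F) :
    letI : Algebra (pthSubfield 2 F) (squareExt x) :=
      (Subfield.inclusion (pthSubfield_le_squareExt x)).toAlgebra
    Module.finrank (pthSubfield 2 F) (squareExt x)
        * Module.finrank (squareExt x) (Submodule.span (squareExt x) (Set.range a))
      = Module.finrank (pthSubfield 2 F)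
        (valueSpan a ⊔ (valueSpan a).map (LinearMap.mulLeft (pthSubfield 2 F) x) :
          Submodule (pthSubfield 2 F) F) := by
  let _ : Algebra (pthSubfield 2 F) (squareExt x) :=
    (Subfield.inclusion (pthSubfield_le_squareExt x)).toAlgebra
  have : IsScalarTower (pthSubfield 2 F) (squareExt x) F := ⟨fun a b c => mul_assoc _ _ _⟩
  let S := Submodule.span (squareExt x) (Set.range a)
  have hS : S.restrictScalars (pthSubfield 2 F)
      = valueSpan a ⊔ (valueSpan a).map (LinearMap.mulLeft (pthSubfield 2 F) x) := by
    have hxS : ∀ v ∈ S, x * v ∈ S := fun v hv => S.smul_mem ⟨x, mem_squareExt x⟩ hv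
    have hle : valueSpan a ≤ S.restrictScalars (pthSubfield 2 F) :=
      Submodule.span_le.2 Submodule.subset_span
    refine le_antisymm ?_ (sup_le hle ?_)
    · let R : Submodule (squareExt x) F :=
        { carrier := (valueSpan a ⊔ (valueSpan a).map (LinearMap.mulLeft (pthSubfield 2 F) x) :
            Submodule (pthSubfield 2 F) F)
          zero_mem' := Submodule.zero_mem _
          add_mem' := Submodule.add_mem _
          smul_mem' := by
            rintro ⟨_, c, hc, d, hd, rfl⟩ z hz
            obtain ⟨v, hv, _, ⟨w, hw, rfl⟩, rfl⟩ := Submodule.mem_sup.1 hz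
            refine Submodule.mem_sup.2 ⟨c * v + d * x ^ 2 * w, ?_, _, ⟨c * w + d * v, ?_, rfl⟩, ?_⟩
            · exact add_mem ((valueSpan a).smul_mem ⟨c, hc⟩ hv)
                ((valueSpan a).smul_mem ⟨_, mul_mem hd (sq_mem x)⟩ hw)
            · exact add_mem ((valueSpan a).smul_mem ⟨c, hc⟩ hw)
                ((valueSpan a).smul_mem ⟨d, hd⟩ hv)
            · simp only [LinearMap.mulLeft_apply, Subfield.smul_def, smul_eq_mul]
              ring }
      have hR : S ≤ R := Submodule.span_le.2 fun z hz =>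
        Submodule.mem_sup_left (Submodule.subset_span hz)
      exact hR
    · rintro _ ⟨v, hv, rfl⟩
      exact hxS v (hle hv)
  rw [Module.finrank_mul_finrank, ← hS]
  rfl

theorem finrank_sup_eq_of_weakVishikEquiv [Fact (Nat.Prime 2)] {ι κ : Type*} [Fintype ι]
    [Fintype κ] {a : ι → F} {b : κ → F} (h : WeakVishikEquiv 2 a b) (x : F) :
    Module.finrank (pthSubfield 2 F)
        (valueSpan a ⊔ (valueSpan a).map (LinearMap.mulLeft (pthSubfield 2 F) x) :
          Submodule (pthSubfield 2 F) F)
      = Module.finrank (pthSubfield 2 F)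
        (valueSpan b ⊔ (valueSpan b).map (LinearMap.mulLeft (pthSubfield 2 F) x) :
          Submodule (pthSubfield 2 F) F) := by
  have hdef := h.2 (squareExt x) (toSquareExt x) ⟨x, mem_squareExt x⟩ ⟨x, rfl⟩
    (closure_toSquareExt x)
  have ha := finrank_add_defect a x
  have hb := finrank_add_defect b x
  rw [← finrank_span_squareExt, ← finrank_span_squareExt]
  congr 1
  have := h.1
  omega

end Defects
end QLF

/-- Over a field of characteristic 2, if the anisotropic part of a
totally singular quadratic form `φ` is minimal over `F`, and `φ`, `ψ` are weakly
Vishik equivalent, then `φ` and `ψ` are similar. -/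
theorem stmt_0 {F : Type u} [Field F] [CharP F 2]
    {n m : ℕ} (φ : Fin n → F) (ψ : Fin m → F)
    (hmin : ∃ (k : ℕ) (φa : Fin k → F), QLF.IsAnisotropicPart 2 φ φa ∧ QLF.Minimal 2 φa)
    (h : QLF.WeakVishikEquiv 2 φ ψ) :
    QLF.Similar 2 φ ψ := by
  obtain ⟨k, φa, hφa, hmin⟩ := hmin
  have hsup := QLF.finrank_sup_eq_of_weakVishikEquiv h
  have hdim : Module.finrank (QLF.pthSubfield 2 F) (QLF.valueSpan φ)
      = Module.finrank (QLF.pthSubfield 2 F) (QLF.valueSpan ψ) := by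
    have hzero : ∀ V : Submodule (QLF.pthSubfield 2 F) F,
        V ⊔ V.map (LinearMap.mulLeft (QLF.pthSubfield 2 F) 0) = V :=
      fun V => sup_eq_left.2 (by rintro _ ⟨v, -, rfl⟩; simp)
    have h0 := hsup 0
    rwa [hzero, hzero] at h0
  have hquot : QLF.quotients (QLF.valueSpan φ : Set F)
      = QLF.quotients (QLF.valueSpan ψ : Set F) := by
    ext x
    by_cases hx : x = 0
    · subst hx
      exact iff_of_false (QLF.zero_notMem_quotients _) (QLF.zero_notMem_quotients _)
    · rw [QLF.mem_quotients_iff _ hx, QLF.mem_quotients_iff _ hx, hsup, hdim]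
  obtain ⟨c, hc, hcV⟩ := QLF.exists_eq_map_mulLeft QLF.sq_mem _ _ hdim hquot
    (QLF.degree_eq_of_minimal hφa hmin)
  refine ⟨c, hc, QLF.isometric_of_valueSpan_eq _ _ h.1 ?_⟩
  rw [hcV, QLF.valueSpan, QLF.valueSpan, Submodule.map_span, ← Set.range_comp]
  rfl
end

section
/- Let φ and ψ be anisotropic diagonal quasilinear p-forms over F of dimension at least 1 such that φ and ψ are weakly Vishik equivalent. Then N_F(φ) = N_F(ψ); consequently nf_F(φ) ≃ nf_F(ψ) and ndeg_F(φ) = ndeg_F(ψ). -/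
/-!
Diagonal quasilinear `p`-forms over a field `F` of characteristic `p`,
following Hoffmann and Zemková. A form of dimension `n` is recorded by its
coefficient tuple `a : ι → F` (for a finite index type `ι`), the form being
`x ↦ ∑ i, a i * (x i)^p`.
-/

universe u

namespace QLF

section PthPowers

variable {p : ℕ} {F : Type*} [Field F]

theorem pow_mem_adjoin (s : Set F) (x : F) : x ^ p ∈ adjoin p s :=
  Subfield.subset_closure (Or.inl ⟨x, rfl⟩)

theorem subset_adjoin (s : Set F) : s ⊆ adjoin p s :=
  fun _ hx => Subfield.subset_closure (Or.inr hx)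

theorem adjoin_le {s : Set F} {N : Subfield F} (hN : ∀ x : F, x ^ p ∈ N) (hs : s ⊆ N) :
    adjoin p s ≤ N := by
  rw [adjoin, Subfield.closure_le]
  rintro y (⟨x, rfl⟩ | hy)
  · exact hN x
  · exact hs hy

theorem pow_mem_pthSubfield (x : F) : x ^ p ∈ pthSubfield p F :=
  Subfield.subset_closure ⟨x, rfl⟩

theorem pow_prime_injective [Fact p.Prime] [CharP F p] {x y : F} (h : x ^ p = y ^ p) : x = y :=
  frobenius_inj F p h

/-- An element of degree `p` over a subfield `N` satisfies no nontrivial relation of degree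
less than `p` over `N`. -/
theorem eq_zero_of_sum_mul_pow_eq_zero [Fact p.Prime] [CharP F p] {N : Subfield F} {a : F}
    (ha : a ∉ N) (hap : a ^ p ∈ N) {g : ℕ → F} (hg : ∀ j, g j ∈ N)
    (hsum : ∑ j ∈ Finset.range p, g j * a ^ j = 0) {j : ℕ} (hj : j < p) : g j = 0 := by
  have hp : p.Prime := Fact.out
  have hirr : Irreducible (Polynomial.X ^ p - Polynomial.C (⟨a ^ p, hap⟩ : N)) := by
    refine X_pow_sub_C_irreducible_of_prime hp fun b hb => ha ?_
    have : (b : F) = a := pow_prime_injective (p := p) (congrArg Subtype.val hb)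
    exact this ▸ b.2
  have hmin := minpoly.eq_of_irreducible_of_monic (x := a) hirr
    (by
      rw [map_sub, Polynomial.aeval_X_pow, Polynomial.aeval_C]
      exact sub_self (a ^ p)) (Polynomial.monic_X_pow_sub_C _ hp.ne_zero)
  have hdeg : (minpoly N a).natDegree = p := by rw [← hmin, Polynomial.natDegree_X_pow_sub_C]
  have hli := linearIndependent_pow (K := N) a
  rw [hdeg, Fintype.linearIndependent_iff] at hli
  have := hli (fun i => ⟨g i, hg i⟩) (by
    rw [← hsum, Finset.sum_range]
    rfl) ⟨j, hj⟩
  exact congrArg Subtype.val this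

end PthPowers

section Values

variable {p : ℕ} {F : Type*} {ι κ : Type*} [Fintype ι] [Fintype κ]

theorem eval_single [CommRing F] [DecidableEq ι] (hp : p ≠ 0) (a : ι → F) (i : ι) (x : F) :
    eval p a (Pi.single i x) = a i * x ^ p := by
  rw [eval, Finset.sum_eq_single i]
  · simp
  · intro j _ hj
    simp [hj, hp]
  · simp

theorem eval_smul [CommRing F] (a : ι → F) (c : F) (x : ι → F) :
    eval p a (c • x) = c ^ p * eval p a x := by
  simp only [eval, Pi.smul_apply, smul_eq_mul, Finset.mul_sum]
  exact Finset.sum_congr rfl fun i _ => by ring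

variable [Field F]

theorem eval_add [Fact p.Prime] [CharP F p] (a x y : ι → F) :
    eval p a (x + y) = eval p a x + eval p a y := by
  simp only [eval, Pi.add_apply, add_pow_char, mul_add, Finset.sum_add_distrib]

theorem eval_sub [Fact p.Prime] [CharP F p] (a x y : ι → F) :
    eval p a (x - y) = eval p a x - eval p a y := by
  rw [eq_sub_iff_add_eq, ← eval_add, sub_add_cancel]

theorem Anisotropic.eval_injective [Fact p.Prime] [CharP F p] {a : ι → F}
    (ha : Anisotropic p a) : Function.Injective (eval p a) := by
  intro x y hxy
  by_contra hne
  exact ha ⟨x - y, sub_ne_zero.2 hne, by rw [eval_sub, hxy, sub_self]⟩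

theorem Anisotropic.eval_ne_zero {a : ι → F} (ha : Anisotropic p a) {x : ι → F} (hx : x ≠ 0) :
    eval p a x ≠ 0 :=
  fun h => ha ⟨x, hx, h⟩

/-- Anisotropic forms with the same values are isometric. -/
theorem isometric_of_values_eq [Fact p.Prime] [CharP F p] {a : ι → F} {b : κ → F}
    (ha : Anisotropic p a) (hb : Anisotropic p b) (h : values p a = values p b) :
    Isometric p a b := by
  have hab : ∀ x, ∃ y, eval p b y = eval p a x := fun x => h.subset ⟨x, rfl⟩
  choose T hT using hab
  let L : (ι → F) →ₗ[F] (κ → F) :=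
    { toFun := T
      map_add' := fun x y => hb.eval_injective (by simp only [eval_add, hT])
      map_smul' := fun c x => hb.eval_injective (by simp only [eval_smul, hT, RingHom.id_apply]) }
  refine ⟨LinearEquiv.ofBijective L ⟨fun x y hxy => ha.eval_injective ?_, fun y => ?_⟩,
    fun x => (hT x).symm⟩
  · rw [← hT x, ← hT y]
    exact congrArg (eval p b) hxy
  · obtain ⟨x, hx⟩ : eval p b y ∈ values p a := h ▸ ⟨y, rfl⟩
    exact ⟨x, hb.eval_injective ((hT x).trans hx)⟩

theorem isotropic_iff_defect_ne_zero [Fact p.Prime] [CharP F p] {a : ι → F} :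
    Isotropic p a ↔ defect p a ≠ 0 := by
  rw [defect, Ne, Submodule.finrank_eq_zero, ← Ne, Submodule.ne_bot_iff]
  exact ⟨fun ⟨x, hx, h⟩ => ⟨x, h, hx⟩, fun ⟨x, h, hx⟩ => ⟨x, hx, h⟩⟩

theorem div_mem_normField {a : ι → F} {u v : F} (hu : u ∈ values p a) (hv : v ∈ values p a) :
    u / v ∈ normField p a := by
  by_cases hu0 : u = 0
  · simp [hu0]
  by_cases hv0 : v = 0
  · simp [hv0]
  exact subset_adjoin _ ⟨u, hu, v, hv, hu0, hv0, rfl⟩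

end Values

section SimpleExtension

variable {p : ℕ} [Fact p.Prime] {F : Type*} [Field F] {E : Type*} [Field E] [CharP E p]
  {ι : Type*} [Fintype ι] {f : F →+* E} {α : E} {a : F}

/-- A form becomes isotropic after adjoining a `p`-th root of a quotient of its values. -/
theorem isotropic_of_pow_eq_div {φ : ι → F} (hα : α ^ p = f a) (ha : ∀ b : F, b ^ p ≠ a)
    {x y : ι → F} (hy : eval p φ y ≠ 0) (hxy : a = eval p φ x / eval p φ y) :
    Isotropic p (f ∘ φ) := by
  have hp : p ≠ 0 := (Fact.out : p.Prime).ne_zero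
  have hmap (w : ι → F) : eval p (f ∘ φ) (f ∘ w) = f (eval p φ w) := by simp [eval]
  refine ⟨f ∘ x - α • (f ∘ y), fun h0 => ?_, ?_⟩
  · have hy0 : y ≠ 0 := by
      rintro rfl
      exact hy (by simp [eval, hp])
    obtain ⟨i, hi⟩ := Function.ne_iff.1 hy0
    have hfi : f (y i) ≠ 0 := (map_ne_zero f).2 hi
    have hxi : f (x i) = α * f (y i) := sub_eq_zero.1 (congrFun h0 i)
    refine ha (x i / y i) (f.injective ?_)
    rw [map_pow, map_div₀, hxi, mul_div_cancel_right₀ _ hfi, hα]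
  · rw [eval_sub, eval_smul, hmap, hmap, hα, ← map_mul, hxy, div_mul_cancel₀ _ hy, sub_self]

/-- An anisotropic form that becomes isotropic after adjoining a `p`-th root of `a` has `a`
in its norm field. -/
theorem mem_normField_of_isotropic [CharP F p] {ψ : ι → F} (hψ : Anisotropic p ψ) (hα : α ^ p = f a)
    (hE : ∀ z : E, ∃ c : ℕ → F, z = ∑ j ∈ Finset.range p, f (c j) * α ^ j)
    (hiso : Isotropic p (f ∘ ψ)) : a ∈ normField p ψ := by
  classical
  have hp : p ≠ 0 := (Fact.out : p.Prime).ne_zero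
  by_contra ha
  obtain ⟨z, hz0, hz⟩ := hiso
  choose c hc using fun i => hE (z i)
  obtain ⟨i₀, hi₀⟩ := Function.ne_iff.1 hz0
  set v := eval p ψ (Pi.single i₀ 1) with hv
  have hv0 : v ≠ 0 := hψ.eval_ne_zero (by simp)
  have hzpow (i : ι) : z i ^ p = f (∑ j ∈ Finset.range p, c i j ^ p * a ^ j) := by
    rw [hc i, sum_pow_char, map_sum]
    refine Finset.sum_congr rfl fun j _ => ?_
    rw [mul_pow, ← pow_mul, mul_comm j, pow_mul, hα, map_mul, map_pow, map_pow]
  have hsum : ∑ j ∈ Finset.range p, eval p ψ (fun i => c i j) / v * a ^ j = 0 := by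
    have h0 : ∑ i, ψ i * ∑ j ∈ Finset.range p, c i j ^ p * a ^ j = 0 := by
      apply f.injective
      rw [map_zero, ← hz, eval, map_sum]
      simp only [map_mul, hzpow, Function.comp_apply]
    calc _ = (∑ i, ψ i * ∑ j ∈ Finset.range p, c i j ^ p * a ^ j) / v := by
          simp only [eval, Finset.sum_div, Finset.sum_mul, Finset.mul_sum]
          rw [Finset.sum_comm]
          exact Finset.sum_congr rfl fun i _ => Finset.sum_congr rfl fun j _ => by ring
      _ = 0 := by rw [h0, zero_div]
  have hcoeff : ∀ j < p, c i₀ j = 0 := fun j hj => by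
    have h0 := eq_zero_of_sum_mul_pow_eq_zero ha (pow_mem_adjoin _ a)
      (fun j => div_mem_normField ⟨_, rfl⟩ ⟨_, rfl⟩) hsum hj
    by_contra hne
    exact hψ.eval_ne_zero (x := fun i => c i j) (Function.ne_iff.2 ⟨i₀, hne⟩)
      ((div_eq_zero_iff.1 h0).resolve_right hv0)
  refine hi₀ ?_
  rw [hc i₀]
  exact Finset.sum_eq_zero fun j hj => by simp [hcoeff j (Finset.mem_range.1 hj)]

end SimpleExtension

theorem normField_le_of_weakVishikEquiv {p : ℕ} [Fact p.Prime] {F : Type u} [Field F] [CharP F p]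
    {ι κ : Type*} [Fintype ι] [Fintype κ] {φ : ι → F} {ψ : κ → F} (hψ : Anisotropic p ψ)
    (h : WeakVishikEquiv p φ ψ) : normField p φ ≤ normField p ψ := by
  refine adjoin_le (pow_mem_adjoin _) ?_
  rintro a ⟨_, ⟨x, rfl⟩, _, ⟨y, rfl⟩, -, hy, hxy⟩
  by_cases ha : ∃ b : F, b ^ p = a
  · obtain ⟨b, rfl⟩ := ha
    exact pow_mem_adjoin _ b
  push Not at ha
  have hp : p.Prime := Fact.out
  have hirr := X_pow_sub_C_irreducible_of_prime hp ha
  have : Fact (Irreducible (Polynomial.X ^ p - Polynomial.C a)) := ⟨hirr⟩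
  let E := AdjoinRoot (Polynomial.X ^ p - Polynomial.C a)
  have : CharP E p := charP_of_injective_algebraMap (algebraMap F E).injective p
  let f : F →+* E := algebraMap F E
  let α : E := AdjoinRoot.root _
  have hα : α ^ p = f a := by
    have h0 := AdjoinRoot.eval₂_root (Polynomial.X ^ p - Polynomial.C a)
    rw [Polynomial.eval₂_sub, Polynomial.eval₂_X_pow, Polynomial.eval₂_C] at h0
    exact sub_eq_zero.1 h0
  have hE (z : E) : ∃ c : ℕ → F, z = ∑ j ∈ Finset.range p, f (c j) * α ^ j := by
    obtain ⟨g, hg, rfl⟩ := (AdjoinRoot.powerBasis hirr.ne_zero).exists_eq_aeval z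
    rw [AdjoinRoot.powerBasis_dim, Polynomial.natDegree_X_pow_sub_C] at hg
    refine ⟨g.coeff, ?_⟩
    rw [Polynomial.aeval_eq_sum_range' hg, AdjoinRoot.powerBasis_gen]
    exact Finset.sum_congr rfl fun j _ => Algebra.smul_def _ _
  have hgen : Subfield.closure (insert α (Set.range f)) = ⊤ := by
    refine eq_top_iff.2 fun z _ => ?_
    obtain ⟨c, rfl⟩ := hE z
    exact sum_mem fun j _ => mul_mem (Subfield.subset_closure (Set.mem_insert_of_mem _ ⟨_, rfl⟩))
      (pow_mem (Subfield.subset_closure (Set.mem_insert _ _)) j)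
  have hiso : Isotropic p (f ∘ ψ) := by
    rw [isotropic_iff_defect_ne_zero, ← h.2 E f α ⟨a, hα.symm⟩ hgen,
      ← isotropic_iff_defect_ne_zero]
    exact isotropic_of_pow_eq_div hα ha hy hxy
  exact mem_normField_of_isotropic hψ hα hE hiso

section Pfister

variable {p : ℕ} [Fact p.Prime] {F : Type*} [Field F] {k : ℕ}

theorem mul_pow_mem_values_pfister (c : Fin k → F) (e : Fin k → ℕ) (x : F) :
    (∏ i, c i ^ e i) * x ^ p ∈ values p (pfister p c) := by
  classical
  have hp : p.Prime := Fact.out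
  refine ⟨Pi.single (fun i => ⟨e i % p, Nat.mod_lt _ hp.pos⟩) ((∏ i, c i ^ (e i / p)) * x), ?_⟩
  rw [eval_single hp.ne_zero, pfister, mul_pow, ← mul_assoc, ← Finset.prod_pow,
    ← Finset.prod_mul_distrib]
  congr 1
  refine Finset.prod_congr rfl fun i _ => ?_
  rw [← pow_mul, ← pow_add, mul_comm (e i / p), Nat.mod_add_div]

/-- The values of a quasi-Pfister form `⟪c₁,…,cₖ⟫` form the field `Fᵖ(c₁,…,cₖ)`. -/
theorem values_pfister [CharP F p] (c : Fin k → F) :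
    values p (pfister p c) = adjoin p (Set.range c) := by
  classical
  have hp : p.Prime := Fact.out
  let A : AddSubgroup F :=
    { carrier := values p (pfister p c)
      zero_mem' := ⟨0, by simp [eval, hp.ne_zero]⟩
      add_mem' := by
        rintro _ _ ⟨x, rfl⟩ ⟨y, rfl⟩
        exact ⟨x + y, eval_add _ _ _⟩
      neg_mem' := by
        rintro _ ⟨x, rfl⟩
        exact ⟨0 - x, by rw [eval_sub]; simp [eval, hp.ne_zero]⟩ }
  have hmul {u v : F} (hu : u ∈ A) (hv : v ∈ A) : u * v ∈ A := by
    obtain ⟨x, rfl⟩ := hu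
    obtain ⟨y, rfl⟩ := hv
    rw [eval, eval, Finset.sum_mul_sum]
    refine sum_mem fun d _ => sum_mem fun e _ => ?_
    have h := mul_pow_mem_values_pfister (p := p) c (fun i => d i + e i) (x d * y e)
    have heq : pfister p c d * x d ^ p * (pfister p c e * y e ^ p) =
        (∏ i, c i ^ ((d i : ℕ) + e i)) * (x d * y e) ^ p := by
      simp only [pow_add, Finset.prod_mul_distrib, pfister]
      ring
    rw [heq]
    exact h
  have hpow (x : F) : x ^ p ∈ A := by
    have h := mul_pow_mem_values_pfister (p := p) c 0 x
    simp only [Pi.zero_apply, pow_zero, Finset.prod_const_one, one_mul] at h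
    exact h
  have hone : (1 : F) ∈ A := by simpa using hpow 1
  have hnpow {u : F} (hu : u ∈ A) (j : ℕ) : u ^ j ∈ A := by
    induction j with
    | zero => simpa using hone
    | succ j ih => exact pow_succ u j ▸ hmul ih hu
  let S : Subfield F :=
    { A with
      mul_mem' := hmul
      one_mem' := hone
      inv_mem' := by
        intro u hu
        by_cases hu0 : u = 0
        · subst hu0
          rwa [inv_zero]
        have heq : u⁻¹ = u ^ (p - 1) * u⁻¹ ^ p := by
          obtain ⟨q, hq⟩ := Nat.exists_eq_succ_of_ne_zero hp.ne_zero
          rw [hq, Nat.succ_sub_one, pow_succ, ← mul_assoc, ← mul_pow, mul_inv_cancel₀ hu0, one_pow,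
            one_mul]
        rw [heq]
        exact hmul (hnpow hu _) (hpow _) }
  refine Set.Subset.antisymm ?_ ?_
  · rintro _ ⟨x, rfl⟩
    exact sum_mem fun e _ => mul_mem
      (prod_mem fun i _ => pow_mem (subset_adjoin _ (Set.mem_range_self i)) _) (pow_mem_adjoin _ _)
  · refine adjoin_le (N := S) hpow ?_
    rintro _ ⟨i, rfl⟩
    have h := mul_pow_mem_values_pfister (p := p) c (Pi.single i 1) 1
    rw [Finset.prod_eq_single i (fun j _ hj => by simp [hj]) (by simp), Pi.single_eq_same, pow_one, one_pow,
      mul_one] at h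
    exact h

/-- A quasi-Pfister form of maximal degree is anisotropic. -/
theorem anisotropic_pfister_of_degOver_eq [CharP F p] {c : Fin k → F}
    (hc : degOver (pthSubfield p F) (adjoin p (Set.range c)) = p ^ k) :
    Anisotropic p (pfister p c) := by
  have hspan : Submodule.span (pthSubfield p F) (adjoin p (Set.range c) : Set F) =
      Submodule.span (pthSubfield p F) (Set.range (pfister p c)) := by
    rw [← values_pfister]
    refine le_antisymm (Submodule.span_le.2 ?_) (Submodule.span_mono ?_)
    · rintro _ ⟨x, rfl⟩
      refine sum_mem fun e _ => ?_
      have h := Submodule.smul_mem (Submodule.span (pthSubfield p F) (Set.range (pfister p c)))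
        (⟨x e ^ p, pow_mem_pthSubfield _⟩ : pthSubfield p F) (Submodule.subset_span ⟨e, rfl⟩)
      rwa [Subfield.smul_def, smul_eq_mul, mul_comm] at h
    · rintro _ ⟨e, rfl⟩
      simpa [pfister] using mul_pow_mem_values_pfister (p := p) c (fun i => e i) 1
  have hli : LinearIndependent (pthSubfield p F) (pfister p c) := by
    rw [linearIndependent_iff_card_eq_finrank_span, Set.finrank, ← hspan]
    rw [degOver] at hc
    simp [hc]
  rintro ⟨x, hx0, hx⟩
  refine hx0 (funext fun e => ?_)
  have h := Fintype.linearIndependent_iff.1 hli (fun e => ⟨x e ^ p, pow_mem_pthSubfield _⟩)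
    (by rw [← hx]; exact Finset.sum_congr rfl fun e _ => mul_comm _ _) e
  exact eq_zero_of_pow_eq_zero (congrArg Subtype.val h)

theorem IsNormForm.anisotropic [CharP F p] {ι : Type*} [Fintype ι] {a : ι → F} {c : Fin k → F}
    (h : IsNormForm p a c) : Anisotropic p (pfister p c) :=
  anisotropic_pfister_of_degOver_eq (h.1 ▸ h.2)

theorem IsNormForm.values_pfister [CharP F p] {ι : Type*} [Fintype ι] {a : ι → F} {c : Fin k → F}
    (h : IsNormForm p a c) : values p (pfister p c) = normField p a := by
  rw [QLF.values_pfister, h.1]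

end Pfister

theorem WeakVishikEquiv.symm {p : ℕ} [Fact p.Prime] {F : Type u} [Field F] [CharP F p]
    {ι κ : Type*} [Fintype ι] [Fintype κ] {φ : ι → F} {ψ : κ → F} (h : WeakVishikEquiv p φ ψ) :
    WeakVishikEquiv p ψ φ :=
  ⟨h.1.symm, fun E _ _ f α hα hE => (h.2 E f α hα hE).symm⟩

end QLF

/-- Weakly Vishik equivalent anisotropic quasilinear `p`-forms of
dimension at least 1 have the same norm field; consequently they have isometric
norm forms and equal norm degrees. -/
theorem stmt_2 (p : ℕ) [Fact p.Prime] {F : Type u} [Field F] [CharP F p]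
    {n m : ℕ} (hn : 1 ≤ n) (hm : 1 ≤ m)
    (φ : Fin n → F) (ψ : Fin m → F)
    (hφ : QLF.Anisotropic p φ) (hψ : QLF.Anisotropic p ψ)
    (h : QLF.WeakVishikEquiv p φ ψ) :
    QLF.normField p φ = QLF.normField p ψ ∧
    QLF.ndeg p φ = QLF.ndeg p ψ ∧
    (∀ (k l : ℕ) (c : Fin k → F) (d : Fin l → F),
      QLF.IsNormForm p φ c → QLF.IsNormForm p ψ d →
      QLF.Isometric p (QLF.pfister p c) (QLF.pfister p d)) := by
  have hN : QLF.normField p φ = QLF.normField p ψ :=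
    le_antisymm (QLF.normField_le_of_weakVishikEquiv hψ h)
      (QLF.normField_le_of_weakVishikEquiv hφ h.symm)
  refine ⟨hN, congrArg (QLF.degOver _) hN, fun k l c d hc hd => ?_⟩
  exact QLF.isometric_of_values_eq hc.anisotropic hd.anisotropic
    (by rw [hc.values_pfister, hd.values_pfister, hN])
end
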